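/- arXiv:1507.03395 — 2 statements merged into one kernel-verified Lean document; each statement's English description precedes it below -/
import Mathlib

section
/- Quantitative finite-blocklength excess bound. Let ch = (Σ, p, *) be a discrete MSB channel with LLR map L and LLR distribution μ given input 0. Let Σ_- = {a ∈ Σ : p(a) < p(a*)} and Σ_+ = {a ∈ Σ : p(a) > p(a*)}, and assume Σ_- is nonempty. Let δ ∈ (0,1) satisfy δ/(1−δ) < p(Σ_+) − p(Σ_-), and let c ∈ (0,1) satisfy Σ_{a∈Σ_-} p(a)·((p(a*)/p(a))^{1−c} − 1) = δ/(1−δ). Define q on Σ by q(a) = ((1−δ)/δ)·p(a)·((p(a*)/p(a))^{1−c} − 1) for a ∈ Σ_- and q(a) = 0 otherwise, and define p' on Σ by p'(a) = δ·q(a) + (1−δ)·p(a) for a ∈ Σ_- and p'(a) = (1−δ)·p(a) otherwise; let μ' be the distribution of L'(a) = ln(p'(a)/p'(a*)) where a ~ p'. Let s = −Σ_a q(a)·L(a) and ε = δs/(2(1−δ)). Then for every n and every convex cone C ⊆ ℝ^n (closed under addition and positive scaling) with C + (ℝ≥0)^n ⊆ C, one has 1 − μ^n(C + ε𝟙) ≤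 (2‖L‖_∞/(δs))·(1 − μ'^n(C)), where 𝟙 ∈ ℝ^n is the all-ones vector and ‖L‖_∞ = max_{a∈Σ} |L(a)|. -/
open Finset

/-- The log-likelihood-ratio map of a channel with output distribution `p` (given input 0)
and pairing involution `st`: `L(a) = ln (p a / p (a*))`. -/
noncomputable def LLR {S : Type*} (p : S → ℝ) (st : S → S) (a : S) : ℝ :=
  Real.log (p a / p (st a))

/-- The probability, under the `n`-fold product of the output distribution `p` (given input 0),
that the LLR vector of the received word lies in the set `C`. -/
noncomputable def llrProb {S : Type*} [Fintype S] (p : S → ℝ) (st : S → S) {n : ℕ}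
    (C : Set (Fin n → ℝ)) : ℝ :=
  ∑ y : Fin n → S, (∏ i, p (y i)) *
    Set.indicator C (fun _ => (1 : ℝ)) (fun i => LLR p st (y i))

/-- A sum over words of a product of letter weights factors as a product of sums. -/
theorem sum_word_prod {S : Type*} [Fintype S] {n : ℕ} (k : Fin n → S → ℝ) :
    ∑ y : Fin n → S, ∏ i, k i (y i) = ∏ i, ∑ b, k i b := by
  classical
  rw [Finset.prod_univ_sum, Fintype.piFinset_univ]

/-- The expectation of a function of one letter under a product of probability weights. -/
theorem sum_word_prod_mul_apply {S : Type*} [Fintype S] {n : ℕ} (k : Fin n → S → ℝ)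
    (hk : ∀ i, ∑ b, k i b = 1) (f : S → ℝ) (j : Fin n) :
    ∑ y : Fin n → S, (∏ i, k i (y i)) * f (y j) = ∑ b, k j b * f b := by
  classical
  have h := sum_word_prod (fun i b => k i b * if i = j then f b else 1)
  simp only [Finset.prod_mul_distrib, Finset.prod_ite_eq', Finset.mem_univ, if_true] at h
  rw [h, Finset.prod_eq_single j]
  · simp
  · intro i _ hij
    simp [hij, hk]
  · simp

/-- If a finitely supported random vector, bounded below by `-M`, lies outside an upward closed
convex cone with probability `β < 1`, then every vector having a positive multiple that dominates
the mean plus `M * β` belongs to the cone. -/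
theorem mem_cone_of_mean_add_le {Ω : Type*} [Fintype Ω] {n : ℕ} (w : Ω → ℝ)
    (hw : ∀ ω, 0 ≤ w ω) (hw1 : ∑ ω, w ω = 1) (X : Ω → Fin n → ℝ) (M : ℝ)
    (hX : ∀ ω i, -M ≤ X ω i) (C : Set (Fin n → ℝ))
    (hC_add : ∀ u ∈ C, ∀ v ∈ C, u + v ∈ C)
    (hC_smul : ∀ v ∈ C, ∀ lam : ℝ, 0 < lam → lam • v ∈ C)
    (hC_mono : ∀ l ∈ C, ∀ u : Fin n → ℝ, (∀ i, 0 ≤ u i) → l + u ∈ C)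
    (β : ℝ) (hβ : ∑ ω, w ω * (1 - C.indicator (fun _ => (1 : ℝ)) (X ω)) = β) (hβ1 : β < 1)
    (t : ℝ) (ht : 0 < t) (v : Fin n → ℝ)
    (hv : ∀ i, ∑ ω, w ω * X ω i + M * β ≤ t * v i) : v ∈ C := by
  classical
  set I : Ω → ℝ := fun ω => C.indicator (fun _ => (1 : ℝ)) (X ω) with hI
  have hI1 : ∀ ω, I ω ≤ 1 := fun ω =>
    Set.indicator_le_self' (fun _ _ => zero_le_one) (X ω)
  set T : Finset Ω := univ.filter (fun ω => 0 < w ω ∧ X ω ∈ C) with hT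
  have hTsum : ∀ g : Ω → ℝ, ∑ ω ∈ T, w ω * g ω = ∑ ω, w ω * g ω * I ω := by
    intro g
    rw [hT, Finset.sum_filter]
    refine Finset.sum_congr rfl fun ω _ => ?_
    by_cases h1 : X ω ∈ C
    · rcases (hw ω).lt_or_eq with h2 | h2
      · simp [hI, h1, h2]
      · simp [← h2]
    · simp [hI, h1]
  have hne : T.Nonempty := by
    by_contra h
    rw [Finset.not_nonempty_iff_eq_empty] at h
    have h1 := hTsum (fun _ => 1)
    simp only [h, Finset.sum_empty, mul_one] at h1
    simp only [mul_sub, mul_one, Finset.sum_sub_distrib, hw1] at hβ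
    linarith
  have hmem : ∑ ω ∈ T, w ω • X ω ∈ C := by
    refine Finset.sum_induction_nonempty _ (· ∈ C) (fun a b ha hb => hC_add a ha b hb) hne ?_
    intro ω hω
    rw [hT, Finset.mem_filter] at hω
    exact hC_smul _ hω.2.2 _ hω.2.1
  have hle : ∀ i, (∑ ω ∈ T, w ω • X ω) i ≤ t * v i := by
    intro i
    refine le_trans ?_ (hv i)
    rw [Finset.sum_apply]
    simp only [Pi.smul_apply, smul_eq_mul]
    rw [hTsum (fun ω => X ω i), ← hβ, Finset.mul_sum, ← Finset.sum_add_distrib]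
    refine Finset.sum_le_sum fun ω _ => ?_
    have := mul_nonneg (mul_nonneg (hw ω) (sub_nonneg.2 (hI1 ω)))
      (by linarith [hX ω i] : 0 ≤ X ω i + M)
    change _ ≤ w ω * X ω i + M * (w ω * (1 - I ω))
    linarith
  have htv : t • v ∈ C := by
    have := hC_mono _ hmem (t • v - ∑ ω ∈ T, w ω • X ω) fun i => by
      simpa only [Pi.sub_apply, Pi.smul_apply, smul_eq_mul, sub_nonneg] using hle i
    rwa [add_sub_cancel] at this
  have := hC_smul _ htv t⁻¹ (inv_pos.2 ht)
  rwa [inv_smul_smul₀ ht.ne'] at this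

/-- The complementary form of `llrProb`. -/
theorem one_sub_llrProb {S : Type*} [Fintype S] (p : S → ℝ) (st : S → S)
    (hp : ∑ a, p a = 1) {n : ℕ} (C : Set (Fin n → ℝ)) :
    1 - llrProb p st C = ∑ y : Fin n → S, (∏ i, p (y i)) *
      (1 - C.indicator (fun _ => (1 : ℝ)) (fun i => LLR p st (y i))) := by
  have h := sum_word_prod (n := n) (fun _ => p)
  simp only [hp, Finset.prod_const_one] at h
  simp only [mul_sub, mul_one, Finset.sum_sub_distrib, h, llrProb]

/-- The distorted channel has LLR map `c • L`. -/
theorem LLR_distorted {S : Type*} (p p' : S → ℝ) (st : S → S) (hst : ∀ a, st (st a) = a)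
    (hp_pos : ∀ a, 0 < p a) (κ c : ℝ) (hκ : 0 < κ)
    (hp' : ∀ a, p' a = if p a < p (st a)
      then κ * (p a * (p (st a) / p a) ^ (1 - c)) else κ * p a) (a : S) :
    LLR p' st a = c * LLR p st a := by
  have h1 := hp_pos a
  have h2 := hp_pos (st a)
  have hr : 0 < p (st a) / p a := div_pos h2 h1
  have hr' : 0 < p a / p (st a) := div_pos h1 h2
  have ha := hp' a
  have hb := hp' (st a)
  rw [hst] at hb
  unfold LLR
  rcases lt_trichotomy (p a) (p (st a)) with h | h | h
  · rw [if_pos h] at ha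
    rw [if_neg h.not_gt] at hb
    have h3 := Real.rpow_pos_of_pos hr (1 - c)
    rw [ha, hb, mul_div_mul_left _ _ hκ.ne', Real.log_div (by positivity) h2.ne',
      Real.log_mul h1.ne' h3.ne', Real.log_rpow hr, Real.log_div h2.ne' h1.ne',
      Real.log_div h1.ne' h2.ne']
    ring
  · rw [if_neg h.not_lt] at ha
    rw [if_neg h.symm.not_lt] at hb
    rw [ha, hb, ← h, div_self h1.ne', div_self (by positivity)]
    simp
  · rw [if_neg h.not_gt] at ha
    rw [if_pos h] at hb
    have h3 := Real.rpow_pos_of_pos hr' (1 - c)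
    rw [ha, hb, mul_div_mul_left _ _ hκ.ne', Real.log_div h1.ne' (by positivity),
      Real.log_mul h2.ne' h3.ne', Real.log_rpow hr', Real.log_div h1.ne' h2.ne']
    ring

/-- Replacing each letter of a word `x` independently with probability `δ` by a letter drawn from
`q` leads outside the cone with probability at least `δ * s / (2 * M)`, provided that `L(x) - ε`
is outside the cone. -/
theorem le_prob_replaced_notMem {S : Type*} [Fintype S] [DecidableEq S] (q L : S → ℝ)
    (hq0 : ∀ a, 0 ≤ q a) (hq1 : ∑ a, q a = 1)
    (δ : ℝ) (hδ0 : 0 < δ) (hδ1 : δ < 1)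
    (s : ℝ) (hs : s = -∑ a, q a * L a)
    (M : ℝ) (hM0 : 0 < M) (hM : ∀ a, |L a| ≤ M)
    {n : ℕ} (C : Set (Fin n → ℝ))
    (hC_add : ∀ u ∈ C, ∀ v ∈ C, u + v ∈ C)
    (hC_smul : ∀ v ∈ C, ∀ lam : ℝ, 0 < lam → lam • v ∈ C)
    (hC_mono : ∀ l ∈ C, ∀ u : Fin n → ℝ, (∀ i, 0 ≤ u i) → l + u ∈ C)
    (x : Fin n → S)
    (hx : (fun i => L (x i) - δ * s / (2 * (1 - δ))) ∉ C) :
    δ * s / (2 * M) ≤ ∑ y : Fin n → S,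
      (∏ i, ((1 - δ) * (if x i = y i then 1 else 0) + δ * q (y i))) *
        (1 - C.indicator (fun _ => (1 : ℝ)) (fun i => L (y i))) := by
  have hδ : 0 < 1 - δ := sub_pos.2 hδ1
  set k : Fin n → S → ℝ := fun i b => (1 - δ) * (if x i = b then 1 else 0) + δ * q b with hk
  have hk0 : ∀ i b, 0 ≤ k i b := by
    intro i b
    have := mul_nonneg hδ0.le (hq0 b)
    have : 0 ≤ (1 - δ) * (if x i = b then 1 else 0) := by
      apply mul_nonneg hδ.le
      split_ifs <;> norm_num
    simp only [hk]
    linarith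
  have hk1 : ∀ i, ∑ b, k i b = 1 := by
    intro i
    simp only [hk, Finset.sum_add_distrib, ← Finset.mul_sum, hq1]
    simp
  have hsM : s ≤ M := by
    rw [hs, ← Finset.sum_neg_distrib]
    calc ∑ a, -(q a * L a) ≤ ∑ a, q a * M := Finset.sum_le_sum fun a _ => by
          have := mul_nonneg (hq0 a) (by linarith [neg_abs_le (L a), hM a] : 0 ≤ M + L a)
          linarith
      _ = M := by rw [← Finset.sum_mul, hq1, one_mul]
  by_contra! hβ
  have hβM := (lt_div_iff₀ (by positivity)).1 hβ
  refine hx (mem_cone_of_mean_add_le (fun y : Fin n → S => ∏ i, k i (y i))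
    (fun y => Finset.prod_nonneg fun i _ => hk0 i _) ?_ (fun y i => L (y i)) M
    (fun y i => (abs_le.1 (hM (y i))).1) C hC_add hC_smul hC_mono _ rfl ?_ (1 - δ) hδ _ ?_)
  · rw [sum_word_prod]
    simp [hk1]
  · refine hβ.trans ?_
    rw [div_lt_one (by positivity)]
    nlinarith
  · intro i
    have hmean : ∑ b, k i b * L b = (1 - δ) * L (x i) - δ * s := by
      simp only [hk, add_mul, mul_assoc, Finset.sum_add_distrib, ← Finset.mul_sum, hs]
      simp
    rw [sum_word_prod_mul_apply k hk1 L i, hmean]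
    have : (1 - δ) * (L (x i) - δ * s / (2 * (1 - δ))) = (1 - δ) * L (x i) - δ * s / 2 := by
      field_simp
    rw [this]
    linarith

/-- **Quantitative finite-blocklength excess bound.**  With the trading distribution `q`,
the distorted distribution `p'`, `s = -E_{Z∼q}[L(Z)]`, `ε = δs/(2(1-δ))` and
`M = ‖L‖_∞`, for every blocklength `n` and every convex cone `C ⊆ ℝ^n` with
`C + (ℝ≥0)^n ⊆ C` one has `1 - μ^n(C + ε𝟙) ≤ (2M/(δs)) (1 - μ'^n(C))`. -/
theorem msb_excess_quantitative {S : Type*} [Fintype S]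
    (p : S → ℝ) (st : S → S)
    (hst : ∀ a, st (st a) = a)
    (hp_pos : ∀ a, 0 < p a) (hp_sum : ∑ a, p a = 1)
    (hneg : ∃ a, p a < p (st a))
    (δ : ℝ) (hδ0 : 0 < δ) (hδ1 : δ < 1)
    (hδsmall : δ / (1 - δ) <
      (∑ a ∈ univ.filter (fun a => p (st a) < p a), p a) -
      (∑ a ∈ univ.filter (fun a => p a < p (st a)), p a))
    (c : ℝ) (hc0 : 0 < c) (hc1 : c < 1)
    (hc : ∑ a ∈ univ.filter (fun a => p a < p (st a)),
        p a * ((p (st a) / p a) ^ (1 - c) - 1) = δ / (1 - δ))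
    (q : S → ℝ)
    (hq : ∀ a, q a = if p a < p (st a)
      then ((1 - δ) / δ) * p a * ((p (st a) / p a) ^ (1 - c) - 1) else 0)
    (p' : S → ℝ)
    (hp' : ∀ a, p' a = if p a < p (st a)
      then δ * q a + (1 - δ) * p a else (1 - δ) * p a)
    (s : ℝ) (hs : s = -∑ a, q a * LLR p st a)
    (ε : ℝ) (hε : ε = δ * s / (2 * (1 - δ)))
    (M : ℝ) (hM : IsGreatest (Set.range fun a => |LLR p st a|) M)
    (n : ℕ) (C : Set (Fin n → ℝ))
    (hC_add : ∀ u ∈ C, ∀ v ∈ C, u + v ∈ C)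
    (hC_smul : ∀ v ∈ C, ∀ lam : ℝ, 0 < lam → lam • v ∈ C)
    (hC_mono : ∀ l ∈ C, ∀ u : Fin n → ℝ, (∀ i, 0 ≤ u i) → l + u ∈ C) :
    1 - llrProb p st ((fun v => v + ε • (1 : Fin n → ℝ)) '' C) ≤
      (2 * M / (δ * s)) * (1 - llrProb p' st C) := by
  classical
  have hδ : 0 < 1 - δ := sub_pos.2 hδ1
  have hM' : ∀ a, |LLR p st a| ≤ M := fun a => hM.2 ⟨a, rfl⟩
  have hrpow : ∀ a, p a < p (st a) → 1 < (p (st a) / p a) ^ (1 - c) := fun a ha =>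
    Real.one_lt_rpow ((one_lt_div (hp_pos a)).2 ha) (sub_pos.2 hc1)
  have hLneg : ∀ a, p a < p (st a) → LLR p st a < 0 := fun a ha =>
    Real.log_neg (div_pos (hp_pos a) (hp_pos _)) ((div_lt_one (hp_pos _)).2 ha)
  have hqpos : ∀ a, p a < p (st a) → 0 < q a := fun a ha => by
    rw [hq, if_pos ha]
    exact mul_pos (mul_pos (div_pos hδ hδ0) (hp_pos a)) (sub_pos.2 (hrpow a ha))
  have hq0 : ∀ a, 0 ≤ q a := fun a => by
    by_cases ha : p a < p (st a)
    · exact (hqpos a ha).le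
    · rw [hq, if_neg ha]
  have hq1 : ∑ a, q a = 1 := by
    simp only [hq, mul_assoc]
    rw [← Finset.sum_filter, ← Finset.mul_sum, hc]
    field_simp
  obtain ⟨a₀, ha₀⟩ := hneg
  have hM0 : 0 < M := (abs_pos.2 (hLneg a₀ ha₀).ne).trans_le (hM' a₀)
  have hs0 : 0 < s := by
    rw [hs, ← Finset.sum_neg_distrib]
    refine Finset.sum_pos' (fun a _ => ?_) ⟨a₀, mem_univ _, ?_⟩
    · by_cases ha : p a < p (st a)
      · nlinarith [hqpos a ha, hLneg a ha]
      · simp [hq a, ha]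
    · nlinarith [hqpos a₀ ha₀, hLneg a₀ ha₀]
  have hmix : ∀ a, p' a = δ * q a + (1 - δ) * p a := fun a => by
    rw [hp', hq]
    split_ifs <;> simp
  have hp'_sum : ∑ a, p' a = 1 := by
    simp only [hmix, Finset.sum_add_distrib, ← Finset.mul_sum, hq1, hp_sum]
    ring
  have hL' : ∀ a, LLR p' st a = c * LLR p st a := by
    refine LLR_distorted p p' st hst hp_pos (1 - δ) c hδ fun a => ?_
    rw [hp', hq]
    split_ifs
    · field_simp
      ring
    · rfl
  have hcone : ∀ v : Fin n → ℝ, (fun i => c * v i) ∈ C ↔ v ∈ C := fun v => by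
    refine ⟨fun h => ?_, fun h => hC_smul v h c hc0⟩
    have := hC_smul _ h c⁻¹ (inv_pos.2 hc0)
    convert this using 1
    ext i
    simp [hc0.ne']
  have hshift : ∀ v : Fin n → ℝ, v ∈ (fun v => v + ε • (1 : Fin n → ℝ)) '' C ↔
      (fun i => v i - ε) ∈ C := fun v => by
    constructor
    · rintro ⟨u, hu, rfl⟩
      simpa using hu
    · intro h
      exact ⟨_, h, by ext i; simp⟩
  set K : S → S → ℝ := fun a b => (1 - δ) * (if a = b then 1 else 0) + δ * q b with hK
  have hp'K : ∀ b, p' b = ∑ a, p a * K a b := fun b => by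
    simp only [hK, mul_add, Finset.sum_add_distrib, ← Finset.sum_mul, hp_sum, hmix]
    simp
    ring
  rw [one_sub_llrProb p st hp_sum, one_sub_llrProb p' st hp'_sum]
  have hexpand : ∀ y : Fin n → S, ∏ i, p' (y i) =
      ∑ x : Fin n → S, (∏ i, p (x i)) * ∏ i, K (x i) (y i) := fun y => by
    simp only [hp'K, ← Finset.prod_mul_distrib]
    rw [sum_word_prod (fun i a => p a * K a (y i))]
  simp only [hexpand, Finset.sum_mul]
  rw [Finset.sum_comm, Finset.mul_sum]
  refine Finset.sum_le_sum fun x _ => ?_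
  simp only [mul_assoc, ← Finset.mul_sum]
  rw [mul_left_comm]
  refine mul_le_mul_of_nonneg_left ?_ (Finset.prod_nonneg fun i _ => (hp_pos _).le)
  have hind : ∀ y : Fin n → S, C.indicator (fun _ => (1 : ℝ)) (fun i => LLR p' st (y i)) =
      C.indicator (fun _ => (1 : ℝ)) (fun i => LLR p st (y i)) := fun y => by
    simp only [hL', Set.indicator_apply, hcone]
  simp only [hind]
  by_cases hx : (fun i => LLR p st (x i) - ε) ∈ C
  · rw [Set.indicator_of_mem ((hshift _).2 hx), sub_self]
    refine mul_nonneg (by positivity) (Finset.sum_nonneg fun y _ => mul_nonneg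
      (Finset.prod_nonneg fun i _ => ?_)
      (sub_nonneg.2 (Set.indicator_le_self' (fun _ _ => zero_le_one) _)))
    refine add_nonneg (mul_nonneg hδ.le ?_) (mul_nonneg hδ0.le (hq0 _))
    split_ifs <;> norm_num
  · rw [Set.indicator_of_notMem (mt (hshift _).1 hx), sub_zero]
    rw [hε] at hx
    have h := le_prob_replaced_notMem q (LLR p st) hq0 hq1 δ hδ0 hδ1 s hs M hM0 hM' C
      hC_add hC_smul hC_mono x hx
    calc (1 : ℝ) = 2 * M / (δ * s) * (δ * s / (2 * M)) := by field_simp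
      _ ≤ _ := mul_le_mul_of_nonneg_left h (by positivity)
end

section
/- Redundant checks do not lower the LP threshold on discrete MSB channels. Let G = {G_n}_n be an infinite family of Tanner graphs, where G_n has n variable nodes and maximum check degree at most a constant d. Let Ḡ = {Ḡ_n}_n be the family obtained by adding all redundant checks, i.e., the checks of Ḡ_n are all the nonzero codewords of the dual code of the code of G_n. Assume G is asymptotically strong and rigid. Let ch = (Σ, p, *) be a discrete MSB channel with LLR distribution μ given input 0. Assume there exists α > 0 such that for every α-distortion ch' of ch, with LLR distribution μ', one has lim_{n→∞} Pr_{l ~ μ'^n}[the P(Ḡ_n)-LP decoder succeeds on l] = 1. Then lim_{n→∞} Pr_{l ~ μ^n}[the P(G_n)-LP decoder succeeds on l] = 1. -/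
open Finset Filter

/-- The binary linear code of a Tanner graph with check set `H ⊆ F₂^n`. -/
def tannerCode {n : ℕ} (H : Set (Fin n → ZMod 2)) : Set (Fin n → ZMod 2) :=
  {x | ∀ h ∈ H, ∑ i, h i * x i = 0}

/-- Embedding of a binary vector into `ℝ^n`. -/
noncomputable def toRealVec {n : ℕ} (x : Fin n → ZMod 2) : Fin n → ℝ :=
  fun i => ((x i).val : ℝ)

/-- The Feldman LP polytope of a Tanner graph with check set `H`: the intersection, over
checks `h`, of the convex hulls of the binary vectors satisfying check `h`. -/
def feldmanPolytope {n : ℕ} (H : Set (Fin n → ZMod 2)) : Set (Fin n → ℝ) :=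
  ⋂ h ∈ H, convexHull ℝ
    {ξ | ∃ x : Fin n → ZMod 2, ξ = toRealVec x ∧ ∑ i, h i * x i = 0}

/-- The `P`-LP decoder succeeds on `l` if `⟨x, l⟩ > 0` for every nonzero `x ∈ P`. -/
def LPsucceeds {n : ℕ} (P : Set (Fin n → ℝ)) (l : Fin n → ℝ) : Prop :=
  ∀ x ∈ P, x ≠ 0 → 0 < ∑ i, x i * l i

/-- The checks of `Ḡ`: all nonzero dual codewords of the code of `H`. -/
def allDualChecks {n : ℕ} (H : Set (Fin n → ZMod 2)) : Set (Fin n → ZMod 2) :=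
  {h | h ≠ 0 ∧ ∀ x ∈ tannerCode H, ∑ i, h i * x i = 0}

/-- The checks of `Ḡ^k`: all nonzero dual codewords of Hamming weight at most `k`. -/
def dualChecksLe {n : ℕ} (H : Set (Fin n → ZMod 2)) (k : ℕ) : Set (Fin n → ZMod 2) :=
  {h | h ∈ allDualChecks H ∧ hammingNorm h ≤ k}

/-- A family of Tanner graphs is asymptotically strong if for every `ε ∈ (0,1]` there is a
`δ > 0` such that for all sufficiently large `n` and every `U ⊆ {1,…,n}` with `|U| ≤ δn`,
the LP decoder of `G n` succeeds on the vector equal to `-1` on `U` and `ε` elsewhere. -/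
def AsympStrong (G : ∀ n : ℕ, Set (Fin n → ZMod 2)) : Prop :=
  ∀ ε : ℝ, 0 < ε → ε ≤ 1 → ∃ δ : ℝ, 0 < δ ∧ ∃ N : ℕ, ∀ n ≥ N,
    ∀ U : Finset (Fin n), (U.card : ℝ) ≤ δ * n →
      LPsucceeds (feldmanPolytope (G n)) (fun i => if i ∈ U then -1 else ε)

/-- A family of Tanner graphs of maximum check degree `d` is rigid if for every constant
`k ≥ d`, the polytope of `Ḡ_n^k` equals the polytope of `G_n` for all large enough `n`. -/
def Rigid (d : ℕ) (G : ∀ n : ℕ, Set (Fin n → ZMod 2)) : Prop :=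
  ∀ k ≥ d, ∃ N : ℕ, ∀ n ≥ N,
    feldmanPolytope (dualChecksLe (G n) k) = feldmanPolytope (G n)

/-- The inequalities that the check `h` imposes on the cone generated by its local polytope. -/
def CheckCone {n : ℕ} (h : Fin n → ZMod 2) (x : Fin n → ℝ) : Prop :=
  ∀ i, h i ≠ 0 → x i ≤ ∑ j ∈ ({j | h j ≠ 0} : Finset (Fin n)).erase i, x j

theorem toRealVec_nonneg {n : ℕ} (x : Fin n → ZMod 2) (i : Fin n) : 0 ≤ toRealVec x i :=
  Nat.cast_nonneg _

theorem nonneg_of_mem_convexHull {n : ℕ} {h : Fin n → ZMod 2} {x : Fin n → ℝ}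
    (hx : x ∈ convexHull ℝ
      {ξ | ∃ x : Fin n → ZMod 2, ξ = toRealVec x ∧ ∑ i, h i * x i = 0}) (i : Fin n) :
    0 ≤ x i := by
  have hsub : convexHull ℝ
      {ξ | ∃ x : Fin n → ZMod 2, ξ = toRealVec x ∧ ∑ i, h i * x i = 0} ⊆ Set.Ici 0 := by
    refine convexHull_min ?_ (convex_Ici 0)
    rintro _ ⟨c, rfl, -⟩
    exact fun i => toRealVec_nonneg c i
  exact hsub hx i

theorem checkCone_of_mem_convexHull {n : ℕ} {h : Fin n → ZMod 2} {x : Fin n → ℝ}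
    (hx : x ∈ convexHull ℝ
      {ξ | ∃ x : Fin n → ZMod 2, ξ = toRealVec x ∧ ∑ i, h i * x i = 0}) :
    CheckCone h x := by
  intro i hi
  set T := ({j | h j ≠ 0} : Finset (Fin n)) with hT
  have hconv : Convex ℝ {x : Fin n → ℝ | x i ≤ ∑ j ∈ T.erase i, x j} := by
    intro x hx y hy a b ha hb _
    simp only [Set.mem_ofPred_eq, Pi.add_apply, Pi.smul_apply, smul_eq_mul, sum_add_distrib,
      ← mul_sum] at hx hy ⊢
    gcongr
  refine convexHull_min ?_ hconv hx
  rintro _ ⟨c, rfl, hc⟩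
  simp only [Set.mem_ofPred_eq]
  have two : ∀ z : ZMod 2, z = 0 ∨ z = 1 := by decide
  rcases two (c i) with h0 | h1
  · calc toRealVec c i = 0 := by simp [toRealVec, h0]
      _ ≤ _ := sum_nonneg fun j _ => toRealVec_nonneg c j
  · obtain ⟨j, hji, hj⟩ : ∃ j, j ≠ i ∧ h j * c j ≠ 0 := by
      by_contra! hcon
      rw [sum_eq_single i (fun j _ hj => hcon j hj) (by simp), h1, mul_one] at hc
      exact hi hc
    have hjT : j ∈ T.erase i := by
      simpa [hT, hji] using left_ne_zero_of_mul hj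
    have hcj : c j = 1 := (two (c j)).resolve_left (right_ne_zero_of_mul hj)
    calc toRealVec c i = toRealVec c j := by simp only [toRealVec, h1, hcj]
      _ ≤ _ := single_le_sum (fun j _ => toRealVec_nonneg c j) hjT

/-- The maximum of a linear functional on a scaled-down point of the check cone is attained
on a word with at most two ones on the support of the check. -/
theorem exists_word_ge {n : ℕ} {h : Fin n → ZMod 2} {x : Fin n → ℝ} (hx0 : ∀ i, 0 ≤ x i)
    (hx1 : ∑ i, x i ≤ 1) (hx : CheckCone h x) (w : Fin n → ℝ) :
    ∃ c : Fin n → ZMod 2, ∑ i, h i * c i = 0 ∧ ∑ i, w i * x i ≤ ∑ i, w i * toRealVec c i := by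
  set T := ({j | h j ≠ 0} : Finset (Fin n)) with hT
  have memT : ∀ j, j ∈ T ↔ h j ≠ 0 := by simp [hT]
  have hle1 : ∀ i, x i ≤ 1 := fun i =>
    (single_le_sum (fun j _ => hx0 j) (mem_univ i)).trans hx1
  have two : ∀ z : ZMod 2, z ≠ 0 → z = 1 := by decide
  -- The coordinates outside the support are free.
  suffices H : ∃ S ⊆ T, ∑ i ∈ S, h i = 0 ∧ ∑ i ∈ T, w i * x i ≤ ∑ i ∈ S, w i by
    obtain ⟨S, hST, hS0, hS⟩ := H
    refine ⟨fun i => if i ∈ S ∨ (i ∉ T ∧ 0 < w i) then 1 else 0, ?_, ?_⟩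
    · refine Eq.trans ?_ hS0
      rw [← sum_subset (subset_univ S)]
      · exact sum_congr rfl fun i hi => by simp [hi]
      · intro i _ hi
        by_cases hiT : i ∈ T
        · simp [hi, hiT]
        · have : h i = 0 := by simpa [memT] using hiT
          simp [this]
    · rw [← sum_add_sum_compl T, ← sum_add_sum_compl T (fun i => w i * toRealVec _ i)]
      refine add_le_add (hS.trans (le_of_eq ?_)) (sum_le_sum fun i hi => ?_)
      · rw [← sum_subset hST]
        · exact sum_congr rfl fun i hi => by simp [toRealVec, hi, ZMod.val_one]
        · intro i hiT hi
          simp [toRealVec, hi, hiT]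
      · have hiT : i ∉ T := by simpa using hi
        have hiS : i ∉ S := fun hc => hiT (hST hc)
        by_cases hw : 0 < w i
        · simp only [toRealVec, hiS, hiT, hw]
          simpa [ZMod.val_one] using mul_le_of_le_one_right hw.le (hle1 i)
        · simp only [toRealVec, hiS, hiT, hw]
          simpa using mul_nonpos_of_nonpos_of_nonneg (not_lt.1 hw) (hx0 i)
  rcases T.eq_empty_or_nonempty with hTe | hTne
  · exact ⟨∅, by simp, by simp, by simp [hTe]⟩
  obtain ⟨i, hiT, hi⟩ := T.exists_max_image w hTne
  have hxi := hx i ((memT i).1 hiT)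
  rcases (T.erase i).eq_empty_or_nonempty with hTe | hTne'
  · rw [← hT, hTe, sum_empty] at hxi
    refine ⟨∅, by simp, by simp, ?_⟩
    rw [← add_sum_erase T _ hiT, hTe, le_antisymm hxi (hx0 i)]
    simp
  obtain ⟨j, hjT, hj⟩ := (T.erase i).exists_max_image w hTne'
  have hji : j ≠ i := ne_of_mem_erase hjT
  have hwij : w j ≤ w i := hi j (mem_of_mem_erase hjT)
  rw [← hT] at hxi
  set b := ∑ j ∈ T.erase i, x j with hb
  have hb1 : b ≤ 1 :=
    (sum_le_sum_of_subset_of_nonneg (subset_univ _) fun j _ _ => hx0 j).trans hx1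
  have hle : ∑ i ∈ T, w i * x i ≤ w i * x i + w j * b := by
    rw [← add_sum_erase T _ hiT, hb, mul_sum]
    gcongr with m hm
    · exact hx0 m
    · exact hj m hm
  have hb0 : 0 ≤ b := (hx0 i).trans hxi
  have h0 := hx0 i
  have h1 := hle1 i
  by_cases hneg : w i + w j ≤ 0
  · refine ⟨∅, by simp, by simp, hle.trans ?_⟩
    rw [sum_empty]
    nlinarith
  · refine ⟨{i, j}, ?_, ?_, hle.trans ?_⟩
    · intro m hm
      rcases mem_insert.1 hm with rfl | hm
      · exact hiT
      · rw [mem_singleton.1 hm]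
        exact mem_of_mem_erase hjT
    · rw [sum_pair hji.symm, two _ ((memT i).1 hiT),
        two _ ((memT j).1 (mem_of_mem_erase hjT))]
      decide
    · rw [sum_pair hji.symm]
      by_cases hwj : 0 ≤ w j <;> nlinarith

theorem mem_convexHull_of_checkCone {n : ℕ} {h : Fin n → ZMod 2} {x : Fin n → ℝ}
    (hx0 : ∀ i, 0 ≤ x i) (hx1 : ∑ i, x i ≤ 1) (hx : CheckCone h x) :
    x ∈ convexHull ℝ
      {ξ | ∃ x : Fin n → ZMod 2, ξ = toRealVec x ∧ ∑ i, h i * x i = 0} := by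
  by_contra hcon
  have hfin : {ξ : Fin n → ℝ | ∃ x : Fin n → ZMod 2,
      ξ = toRealVec x ∧ ∑ i, h i * x i = 0}.Finite :=
    (Set.finite_range (toRealVec (n := n))).subset fun _ ⟨c, hc, _⟩ => ⟨c, hc.symm⟩
  obtain ⟨f, u, hfu, hux⟩ := geometric_hahn_banach_closed_point (convex_convexHull ℝ _)
    (hfin.isClosed_convexHull ℝ) hcon
  have hf : ∀ v : Fin n → ℝ, f v = ∑ i, f (Pi.single i 1) * v i := fun v => by
    have := LinearMap.pi_apply_eq_sum_univ (f : (Fin n → ℝ) →ₗ[ℝ] ℝ) v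
    simp only [ContinuousLinearMap.coe_coe, smul_eq_mul] at this
    rw [this]
    refine sum_congr rfl fun i _ => ?_
    rw [mul_comm]
    congr 2
    ext j
    simp [Pi.single_apply, eq_comm]
  obtain ⟨c, hc0, hc⟩ := exists_word_ge hx0 hx1 hx fun i => f (Pi.single i 1)
  rw [← hf, ← hf] at hc
  have := hfu _ (subset_convexHull ℝ _ ⟨c, rfl, hc0⟩)
  linarith

theorem smul_mem_feldmanPolytope {n : ℕ} {H : Set (Fin n → ZMod 2)} {x : Fin n → ℝ}
    (hx0 : ∀ i, 0 ≤ x i) (hpos : 0 < ∑ i, x i) (hx : ∀ h ∈ H, CheckCone h x) :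
    (∑ i, x i)⁻¹ • x ∈ feldmanPolytope H := by
  have hinv : 0 ≤ (∑ i, x i)⁻¹ := inv_nonneg.2 hpos.le
  refine Set.mem_iInter₂.2 fun h hh => mem_convexHull_of_checkCone
    (fun i => mul_nonneg hinv (hx0 i)) ?_ fun i hi => ?_
  · simp only [Pi.smul_apply, smul_eq_mul, ← mul_sum]
    exact (inv_mul_cancel₀ hpos.ne').le
  · simp only [Pi.smul_apply, smul_eq_mul, ← mul_sum]
    exact mul_le_mul_of_nonneg_left (hx h hh i hi) hinv

theorem nonneg_of_mem_feldmanPolytope {n : ℕ} {H : Set (Fin n → ZMod 2)} (hH : H.Nonempty)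
    {x : Fin n → ℝ} (hx : x ∈ feldmanPolytope H) (i : Fin n) : 0 ≤ x i := by
  obtain ⟨h, hh⟩ := hH
  exact nonneg_of_mem_convexHull (Set.mem_iInter₂.1 hx h hh) i

theorem nonempty_of_LPsucceeds {n : ℕ} (hn : 0 < n) {H : Set (Fin n → ZMod 2)}
    {l : Fin n → ℝ} (hl : LPsucceeds (feldmanPolytope H) l) : H.Nonempty := by
  by_contra hH
  rw [Set.not_nonempty_iff_eq_empty] at hH
  subst hH
  have huniv : feldmanPolytope (∅ : Set (Fin n → ZMod 2)) = Set.univ := by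
    simp [feldmanPolytope]
  have : NeZero n := ⟨hn.ne'⟩
  have hne : (fun _ : Fin n => (1 : ℝ)) ≠ 0 := fun h => one_ne_zero (congrFun h 0)
  have h1 := hl (fun _ => 1) (huniv ▸ Set.mem_univ _) hne
  have h2 := hl (-fun _ => 1) (huniv ▸ Set.mem_univ _) (neg_ne_zero.2 hne)
  simp at h1 h2
  linarith

theorem max_min_le_sum {ι : Type*} {s : Finset ι} (hs : s.Nonempty) {f : ι → ℝ}
    {a b t : ℝ} (ha : 0 ≤ a) (ht : t ≤ ∑ j ∈ s, f j) :
    max a (min t b) ≤ ∑ j ∈ s, max a (min (f j) b) := by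
  have hnn : ∀ j ∈ s, 0 ≤ max a (min (f j) b) := fun j _ => ha.trans (le_max_left _ _)
  by_cases hb : ∃ j ∈ s, b ≤ f j
  · obtain ⟨j, hj, hbj⟩ := hb
    refine le_trans ?_ (single_le_sum hnn hj)
    rw [min_eq_right hbj]
    exact max_le_max le_rfl (min_le_right _ _)
  · push Not at hb
    refine max_le ?_ ((min_le_left _ _).trans (ht.trans (sum_le_sum fun j hj => ?_)))
    · obtain ⟨j, hj⟩ := hs
      exact (le_max_left _ _).trans (single_le_sum hnn hj)
    · rw [min_eq_left (hb j hj).le]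
      exact le_max_right _ _

/-- Truncation of the points of the low-degree polytope, from below at `a` and from above at `b`,
except on the coordinates which the code forces to vanish. -/
theorem exists_clip_checkCone {n k : ℕ} {H : Set (Fin n → ZMod 2)} {x : Fin n → ℝ} {a b : ℝ}
    (hk : 1 ≤ k) (ha : 0 ≤ a) (hab : a ≤ b) (hbk : b ≤ k * a) (hx0 : ∀ i, 0 ≤ x i)
    (hx : x ∈ feldmanPolytope (dualChecksLe H k)) :
    ∃ z : Fin n → ℝ, (∀ h ∈ allDualChecks H, CheckCone h z) ∧
      ∀ i, z i = max a (min (x i) b) ∨ (x i = 0 ∧ z i = 0) := by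
  classical
  set Z : Fin n → Prop := fun i => Pi.single i 1 ∈ allDualChecks H with hZ
  have hlow : ∀ h ∈ dualChecksLe H k, CheckCone h x := fun h hh =>
    checkCone_of_mem_convexHull (Set.mem_iInter₂.1 hx h hh)
  have hxZ : ∀ i, Z i → x i = 0 := fun i hi => by
    have hle := hlow (Pi.single i 1) ⟨hi, ?_⟩ i (by simp)
    · refine le_antisymm (hle.trans (sum_eq_zero fun j hj => ?_).le) (hx0 i)
      simp only [mem_erase, mem_filter, mem_univ, true_and] at hj
      exact absurd (Pi.single_eq_of_ne hj.1 _) hj.2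
    · refine le_trans (card_le_card (t := {i}) fun j hj => ?_) hk
      by_contra hji
      rw [mem_singleton] at hji
      simp [Pi.single_eq_of_ne hji] at hj
  have htwo : ∀ z : ZMod 2, z ≠ 0 → z = 1 := by decide
  set z : Fin n → ℝ := fun i => if Z i then 0 else max a (min (x i) b) with hz
  have hz0 : ∀ i, 0 ≤ z i := fun i => by
    simp only [hz]
    split_ifs
    · exact le_rfl
    · exact ha.trans (le_max_left _ _)
  refine ⟨z, fun h hh i hi => ?_, fun i => ?_⟩
  · by_cases hiZ : Z i
    · simpa only [hz, hiZ, if_true] using sum_nonneg fun j _ => hz0 j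
    set h' : Fin n → ZMod 2 := fun j => if Z j then 0 else h j with hh'
    have hi' : h' i ≠ 0 := by simpa [hh', hiZ] using hi
    have hdual : h' ∈ allDualChecks H := by
      refine ⟨fun h0 => hi' (congrFun h0 i), fun c hc => ?_⟩
      rw [← hh.2 c hc]
      refine sum_congr rfl fun j _ => ?_
      by_cases hj : Z j
      · have : c j = 0 := by simpa [Pi.single_apply] using hj.2 c hc
        simp [this]
      · simp [hh', hj]
    set T' := ({j | h' j ≠ 0} : Finset (Fin n)) with hT'
    have hiT' : i ∈ T' := by simpa [hT'] using hi'
    have hzT' : ∀ j ∈ T', z j = max a (min (x j) b) := fun j hj => by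
      have : ¬ Z j := fun hjZ => by simp [hT', hh', hjZ] at hj
      simp [hz, this]
    have hsub : T'.erase i ⊆ ({j | h j ≠ 0} : Finset (Fin n)).erase i := by
      refine erase_subset_erase _ fun j hj => ?_
      simp only [hT', hh', mem_filter, mem_univ, true_and, ne_eq, ite_eq_left_iff,
        not_forall] at hj ⊢
      exact hj.2
    refine le_trans ?_ (sum_le_sum_of_subset_of_nonneg hsub fun j _ _ => hz0 j)
    rw [hzT' i hiT', sum_congr rfl fun j hj => hzT' j (mem_of_mem_erase hj)]
    by_cases hcard : hammingNorm h' ≤ k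
    · refine max_min_le_sum ?_ ha (hlow h' ⟨hdual, hcard⟩ i hi')
      by_contra hne
      rw [not_nonempty_iff_eq_empty] at hne
      refine hiZ ?_
      have heq : h' = Pi.single i 1 := by
        ext j
        by_cases hji : j = i
        · subst hji
          rw [Pi.single_eq_same, htwo _ hi']
        · rw [Pi.single_eq_of_ne hji]
          by_contra hj
          have : j ∈ T'.erase i := by simpa [hT', hji] using hj
          simp [hne] at this
      rwa [heq] at hdual
    · have hcard' : k ≤ (T'.erase i).card := by
        rw [card_erase_of_mem hiT']
        have : hammingNorm h' = T'.card := rfl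
        omega
      calc max a (min (x i) b) ≤ b := max_le hab (min_le_right _ _)
        _ ≤ k * a := hbk
        _ ≤ (T'.erase i).card * a := by gcongr
        _ ≤ _ := by
          rw [← nsmul_eq_mul]
          exact card_nsmul_le_sum _ _ _ fun j _ => le_max_left _ _
  · by_cases hi : Z i
    · exact Or.inr ⟨hxZ i hi, by simp [hz, hi]⟩
    · exact Or.inl (by simp [hz, hi])

/-- For strong and rigid families, if all points of the polytope with all redundant checks have
nonnegative cost after lowering the LLRs by `ρ`, then the base decoder succeeds. -/
theorem eventually_LPsucceeds_of_forall_nonneg {d : ℕ} {G : ∀ n : ℕ, Set (Fin n → ZMod 2)}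
    (hstrong : AsympStrong G) (hrigid : Rigid d G) {B ρ : ℝ} (hB : 0 ≤ B) (hρ : 0 < ρ) :
    ∀ᶠ n in atTop, ∀ l : Fin n → ℝ, (∀ i, |l i| ≤ B) →
      (∀ x ∈ feldmanPolytope (allDualChecks (G n)), (∀ i, 0 ≤ x i) →
        0 ≤ ∑ i, x i * (l i - ρ)) →
      LPsucceeds (feldmanPolytope (G n)) l := by
  set e : ℝ := ρ / (2 * B + ρ) / 2 with he
  have hden : 0 < 2 * B + ρ := by positivity
  have he0 : 0 < e := by positivity
  have heq : e * (2 * B + ρ) = ρ / 2 := by rw [he]; field_simp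
  have he1 : e ≤ 1 := by nlinarith
  obtain ⟨δ, hδ, N₁, hN₁⟩ := hstrong e he0 he1
  set M : ℝ := max (1 / δ) 1 with hM
  have hM1 : 1 ≤ M := le_max_right _ _
  have hMδ : 1 ≤ M * δ := by
    have : 1 / δ ≤ M := le_max_left _ _
    rwa [div_le_iff₀ hδ] at this
  obtain ⟨k₀, hk₀⟩ := exists_nat_ge (M / e)
  set k := max (max d k₀) 1 with hk
  obtain ⟨N₂, hN₂⟩ := hrigid k ((le_max_left _ _).trans (le_max_left _ _))
  have hk1 : 1 ≤ k := le_max_right _ _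
  have hMk : M ≤ k * e := by
    have h1 : (k₀ : ℝ) ≤ k := by
      exact_mod_cast (le_max_right d k₀).trans (le_max_left _ _)
    rw [← div_le_iff₀ he0]
    exact hk₀.trans h1
  filter_upwards [eventually_ge_atTop N₁, eventually_ge_atTop N₂, eventually_gt_atTop 0]
    with n hn₁ hn₂ hn l hl hall x hxP hxne
  have hnpos : (0 : ℝ) < n := by exact_mod_cast hn
  have hGne : (G n).Nonempty :=
    nonempty_of_LPsucceeds hn (hN₁ n hn₁ ∅ (by simpa using by positivity))
  have hx0 : ∀ i, 0 ≤ x i := nonneg_of_mem_feldmanPolytope hGne hxP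
  by_contra! hcost
  have hXpos : 0 < ∑ i, x i := by
    refine lt_of_le_of_ne (sum_nonneg fun i _ => hx0 i) fun h0 => hxne ?_
    ext i
    exact (sum_eq_zero_iff_of_nonneg fun i _ => hx0 i).1 h0.symm i (mem_univ i)
  obtain ⟨s, hs⟩ : ∃ s : ℝ, s = (∑ i, x i) / n := ⟨_, rfl⟩
  have hspos : 0 < s := by rw [hs]; positivity
  have hns : ∑ i, x i = n * s := by rw [hs]; field_simp
  set U : Finset (Fin n) := {i | M * s < x i} with hU
  have hUcard : (U.card : ℝ) ≤ δ * n := by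
    have h1 : (U.card : ℝ) * (M * s) ≤ n * s := by
      rw [← hns, ← nsmul_eq_mul]
      refine (card_nsmul_le_sum _ _ _ fun i hi => ?_).trans
        (sum_le_sum_of_subset_of_nonneg (subset_univ U) fun i _ _ => hx0 i)
      exact (mem_filter.1 hi).2.le
    have h2 : (U.card : ℝ) * M ≤ n := by
      refine le_of_mul_le_mul_right ?_ hspos
      linarith
    have h3 : (0 : ℝ) ≤ U.card := Nat.cast_nonneg _
    nlinarith
  have hUsum : ∑ i, (if i ∈ U then x i else 0) ≤ e * (n * s) := by
    have h1 := hN₁ n hn₁ U hUcard x hxP hxne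
    have h2 : ∑ i, x i * (if i ∈ U then (-1 : ℝ) else e) ≤
        ∑ i, (e * x i - if i ∈ U then x i else 0) := by
      refine sum_le_sum fun i _ => ?_
      have := mul_nonneg he0.le (hx0 i)
      split_ifs <;> linarith
    rw [sum_sub_distrib, ← mul_sum, hns] at h2
    linarith
  rw [← hN₂ n hn₂] at hxP
  obtain ⟨z, hzcone, hz⟩ := exists_clip_checkCone (a := e * s) (b := M * s) hk1
    (by positivity) (by nlinarith) (by nlinarith) hx0 hxP
  have hbounds : ∀ i, 0 ≤ z i ∧ x i - (if i ∈ U then x i else 0) ≤ z i ∧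
      |z i - x i| ≤ e * s + if i ∈ U then x i else 0 := fun i => by
    have hes : 0 < e * s := by positivity
    have hMs : e * s ≤ M * s := by nlinarith
    have hxi := hx0 i
    rcases hz i with hzi | ⟨hxi0, hzi⟩
    · rw [hzi]
      by_cases hi : M * s < x i
      · have hiU : i ∈ U := by simpa [hU] using hi
        rw [if_pos hiU, min_eq_right hi.le, max_eq_right hMs, abs_le]
        refine ⟨?_, ?_, ?_, ?_⟩ <;> linarith
      · have hiU : i ∉ U := by simpa [hU] using hi
        rw [if_neg hiU, min_eq_left (not_lt.1 hi), abs_le]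
        rcases max_cases (e * s) (x i) with ⟨h1, h2⟩ | ⟨h1, h2⟩ <;> rw [h1] <;>
          refine ⟨?_, ?_, ?_, ?_⟩ <;> linarith
    · rw [hzi, hxi0]
      simp [hes.le]
  have hzpos : 0 < ∑ i, z i := by
    have h1 := sum_le_sum fun i (_ : i ∈ univ) => (hbounds i).2.1
    rw [sum_sub_distrib, hns] at h1
    have : 0 < n * s := by positivity
    nlinarith
  have hz_cost := hall _ (smul_mem_feldmanPolytope (fun i => (hbounds i).1) hzpos hzcone)
    fun i => mul_nonneg (inv_nonneg.2 hzpos.le) (hbounds i).1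
  simp only [Pi.smul_apply, smul_eq_mul, mul_assoc, ← mul_sum] at hz_cost
  have hz_cost' : 0 ≤ ∑ i, z i * (l i - ρ) := by
    by_contra! hneg
    exact absurd hz_cost (not_le.2 (mul_neg_of_pos_of_neg (inv_pos.2 hzpos) hneg))
  have hterm : ∀ i, z i * (l i - ρ) ≤ x i * l i + B * (e * s) +
      (B + ρ) * (if i ∈ U then x i else 0) - ρ * x i := fun i => by
    obtain ⟨-, h2, h3⟩ := hbounds i
    have h4 : (z i - x i) * l i ≤ (e * s + if i ∈ U then x i else 0) * B := by
      refine (le_abs_self _).trans ?_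
      rw [abs_mul]
      exact mul_le_mul h3 (hl i) (abs_nonneg _) ((abs_nonneg _).trans h3)
    nlinarith
  have hsum := sum_le_sum fun i (_ : i ∈ univ) => hterm i
  rw [sum_sub_distrib, sum_add_distrib, sum_add_distrib, sum_const, card_univ,
    Fintype.card_fin, nsmul_eq_mul, ← mul_sum, ← mul_sum, hns] at hsum
  have h5 : (B + ρ) * ∑ i, (if i ∈ U then x i else 0) ≤ (B + ρ) * (e * (n * s)) := by gcongr
  have h6 : 0 < n * s := by positivity
  have h7 : 0 ≤ n * s * (e * (2 * B + ρ) - ρ) := by linarith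
  rw [heq] at h7
  nlinarith

theorem LLR_involution {S : Type*} {p : S → ℝ} {st : S → S} (hst : ∀ a, st (st a) = a) (a : S) :
    LLR p st (st a) = -LLR p st a := by
  rw [LLR, LLR, hst, ← Real.log_inv, inv_div]

section Channel

variable {S : Type*} [Fintype S]

theorem sum_prod_eq_one {n : ℕ} {f : Fin n → S → ℝ} (hf : ∀ i, ∑ a, f i a = 1) :
    ∑ y : Fin n → S, ∏ i, f i (y i) = 1 := by
  classical
  have := prod_univ_sum (fun _ : Fin n => (univ : Finset S)) f
  rw [Fintype.piFinset_univ] at this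
  rw [← this]
  exact prod_eq_one fun i _ => hf i

theorem sum_prod_mul_apply {n : ℕ} {f : Fin n → S → ℝ} (hf : ∀ i, ∑ a, f i a = 1)
    (g : S → ℝ) (i : Fin n) :
    ∑ y : Fin n → S, (∏ j, f j (y j)) * g (y i) = ∑ a, f i a * g a := by
  classical
  have := prod_univ_sum (fun _ : Fin n => (univ : Finset S))
    (fun j a => f j a * if j = i then g a else 1)
  rw [Fintype.piFinset_univ] at this
  simp only [prod_mul_distrib, prod_ite_eq', mem_univ, if_true] at this
  rw [← this, prod_eq_single i]
  · simp
  · intro j _ hj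
    simp [hj, hf j]
  · simp

theorem sum_prod_eq_sum_sum_kernel {n : ℕ} {p p' : S → ℝ} {W : S → S → ℝ}
    (hp' : ∀ b, p' b = ∑ a, p a * W a b) (z : Fin n → S) :
    ∏ i, p' (z i) = ∑ y : Fin n → S, (∏ i, p (y i)) * ∏ i, W (y i) (z i) := by
  classical
  have := prod_univ_sum (fun _ : Fin n => (univ : Finset S)) fun i a => p a * W a (z i)
  rw [Fintype.piFinset_univ] at this
  simp only [hp', this, prod_mul_distrib]

theorem llrProb_le_one {p : S → ℝ} {st : S → S} (hp : ∀ a, 0 ≤ p a) (hp1 : ∑ a, p a = 1)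
    {n : ℕ} (C : Set (Fin n → ℝ)) : llrProb p st C ≤ 1 := by
  rw [← sum_prod_eq_one (n := n) (f := fun _ => p) fun _ => hp1]
  refine sum_le_sum fun y _ => mul_le_of_le_one_right (prod_nonneg fun i _ => hp _) ?_
  exact Set.indicator_le_self' (fun _ _ => zero_le_one) _

/-- Averaging the successes of a decoder over the outputs of a kernel: if the decoder succeeds
with large conditional probability, then it nearly succeeds on the conditional mean. -/
theorem sum_mul_nonneg_of_lt_success {p' : S → ℝ} {st : S → S} {W : S → S → ℝ}
    (hW0 : ∀ a b, 0 ≤ W a b) (hW1 : ∀ a, ∑ b, W a b = 1) {B γ : ℝ}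
    (hB : ∀ a, |LLR p' st a| ≤ B) {n : ℕ} {P : Set (Fin n → ℝ)} (y : Fin n → S)
    (hy : 1 - γ < ∑ z : Fin n → S, (∏ i, W (y i) (z i)) *
      Set.indicator {l | LPsucceeds P l} (fun _ => (1 : ℝ)) (fun i => LLR p' st (z i)))
    {x : Fin n → ℝ} (hxP : x ∈ P) (hx0 : ∀ i, 0 ≤ x i) :
    0 ≤ ∑ i, x i * (∑ b, W (y i) b * LLR p' st b + γ * B) := by
  rcases eq_or_ne x 0 with rfl | hx
  · simp
  set w : (Fin n → S) → ℝ := fun z => ∏ i, W (y i) (z i) with hw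
  set I : (Fin n → S) → ℝ := fun z =>
    Set.indicator {l | LPsucceeds P l} (fun _ => (1 : ℝ)) (fun i => LLR p' st (z i)) with hI
  have hw0 : ∀ z, 0 ≤ w z := fun z => prod_nonneg fun i _ => hW0 _ _
  have hw1 : ∑ z, w z = 1 := sum_prod_eq_one (f := fun i => W (y i)) fun i => hW1 _
  have hI01 : ∀ z, 0 ≤ I z ∧ I z ≤ 1 := fun z =>
    ⟨Set.indicator_nonneg (fun _ _ => zero_le_one) _,
      Set.indicator_le_self' (fun _ _ => zero_le_one) _⟩
  have hgood : ∀ z, 0 ≤ I z * ∑ i, x i * LLR p' st (z i) := fun z => by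
    by_cases hz : LPsucceeds P (fun i => LLR p' st (z i))
    · exact mul_nonneg (hI01 z).1 (hz x hxP hx).le
    · have : I z = 0 := Set.indicator_of_notMem (by simpa using hz) _
      simp [this]
  have hterm : ∀ z i, w z * I z * LLR p' st (z i) ≤
      w z * LLR p' st (z i) + (w z - w z * I z) * B := fun z i => by
    have h1 := (abs_le.1 (hB (z i))).1
    have h2 : 0 ≤ w z * (1 - I z) := mul_nonneg (hw0 z) (by linarith [(hI01 z).2])
    nlinarith
  calc 0 ≤ ∑ z, w z * (I z * ∑ i, x i * LLR p' st (z i)) :=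
        sum_nonneg fun z _ => mul_nonneg (hw0 z) (hgood z)
    _ = ∑ i, x i * ∑ z, w z * I z * LLR p' st (z i) := by
        simp only [mul_sum]
        rw [sum_comm]
        refine sum_congr rfl fun i _ => sum_congr rfl fun z _ => by ring
    _ ≤ ∑ i, x i * ∑ z, (w z * LLR p' st (z i) + (w z - w z * I z) * B) :=
        sum_le_sum fun i _ => mul_le_mul_of_nonneg_left
          (sum_le_sum fun z _ => hterm z i) (hx0 i)
    _ ≤ _ := by
        refine sum_le_sum fun i _ => mul_le_mul_of_nonneg_left ?_ (hx0 i)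
        rw [sum_add_distrib, ← sum_mul, sum_sub_distrib, hw1,
          sum_prod_mul_apply (f := fun i => W (y i)) (fun i => hW1 _)]
        have hB0 : 0 ≤ B := (abs_nonneg _).trans (hB (y i))
        gcongr
        linarith

/-- Transfer of success with high probability from the channel `p'` with all redundant checks to
the channel `p` with the base checks, when `p'` is obtained from `p` by a kernel `W` which
strictly decreases the mean of the LLRs, up to scaling. -/
theorem tendsto_llrProb_of_kernel {p p' : S → ℝ} {st : S → S}
    (hp : ∀ a, 0 ≤ p a) (hp1 : ∑ a, p a = 1)
    {d : ℕ} {G : ∀ n : ℕ, Set (Fin n → ZMod 2)}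
    (hstrong : AsympStrong G) (hrigid : Rigid d G)
    {W : S → S → ℝ} (hW0 : ∀ a b, 0 ≤ W a b) (hW1 : ∀ a, ∑ b, W a b = 1)
    (hp' : ∀ b, p' b = ∑ a, p a * W a b) {A ρ : ℝ} (hA : 0 < A) (hρ : 0 < ρ)
    (hdec : ∀ a, A * ∑ b, W a b * LLR p' st b ≤ LLR p st a - ρ)
    (hlim : Tendsto (fun n => llrProb p' st
        {l : Fin n → ℝ | LPsucceeds (feldmanPolytope (allDualChecks (G n))) l})
      atTop (nhds 1)) :
    Tendsto (fun n => llrProb p st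
        {l : Fin n → ℝ | LPsucceeds (feldmanPolytope (G n)) l})
      atTop (nhds 1) := by
  set B := ∑ a, |LLR p st a| with hBdef
  set B' := ∑ a, |LLR p' st a| with hB'def
  have hB : ∀ a, |LLR p st a| ≤ B := fun a =>
    single_le_sum (f := fun a => |LLR p st a|) (fun _ _ => abs_nonneg _) (mem_univ a)
  have hB' : ∀ a, |LLR p' st a| ≤ B' := fun a =>
    single_le_sum (f := fun a => |LLR p' st a|) (fun _ _ => abs_nonneg _) (mem_univ a)
  have hB0 : 0 ≤ B := sum_nonneg fun _ _ => abs_nonneg _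
  have hB'0 : 0 ≤ B' := sum_nonneg fun _ _ => abs_nonneg _
  set γ := ρ / (2 * A * (B' + 1)) with hγ
  have hγ0 : 0 < γ := by positivity
  have hγB : A * (γ * B') ≤ ρ / 2 := by
    have : A * (γ * (B' + 1)) = ρ / 2 := by rw [hγ]; field_simp
    nlinarith
  have hlow : Tendsto (fun n => 1 - (1 - llrProb p' st
        {l : Fin n → ℝ | LPsucceeds (feldmanPolytope (allDualChecks (G n))) l}) / γ)
      atTop (nhds 1) := by
    simpa using ((hlim.const_sub 1).div_const γ).const_sub 1
  refine tendsto_of_tendsto_of_tendsto_of_le_of_le' hlow tendsto_const_nhds ?_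
    (Eventually.of_forall fun n => llrProb_le_one hp hp1 _)
  filter_upwards [eventually_LPsucceeds_of_forall_nonneg hstrong hrigid hB0 (half_pos hρ)]
    with n hn
  set F : (Fin n → S) → ℝ := fun y => ∑ z : Fin n → S, (∏ i, W (y i) (z i)) *
    Set.indicator {l : Fin n → ℝ | LPsucceeds (feldmanPolytope (allDualChecks (G n))) l}
      (fun _ => (1 : ℝ)) (fun i => LLR p' st (z i)) with hF
  have hF1 : ∀ y, F y ≤ 1 := fun y => by
    rw [← sum_prod_eq_one (n := n) (f := fun i => W (y i)) fun i => hW1 _]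
    refine sum_le_sum fun z _ => mul_le_of_le_one_right (prod_nonneg fun i _ => hW0 _ _) ?_
    exact Set.indicator_le_self' (fun _ _ => zero_le_one) _
  have hprob : llrProb p' st
      {l : Fin n → ℝ | LPsucceeds (feldmanPolytope (allDualChecks (G n))) l} =
      ∑ y : Fin n → S, (∏ i, p (y i)) * F y := by
    simp only [llrProb, hF, sum_prod_eq_sum_sum_kernel hp', sum_mul, mul_sum]
    rw [sum_comm]
    simp only [mul_assoc]
  have htot : ∑ y : Fin n → S, ∏ i, p (y i) = 1 := sum_prod_eq_one fun _ => hp1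
  have hpt : ∀ y : Fin n → S, 1 - (1 - F y) / γ ≤
      Set.indicator {l : Fin n → ℝ | LPsucceeds (feldmanPolytope (G n)) l}
        (fun _ => (1 : ℝ)) (fun i => LLR p st (y i)) := fun y => by
    by_cases hy : 1 - γ < F y
    · have hmem : (fun i => LLR p st (y i)) ∈
          {l : Fin n → ℝ | LPsucceeds (feldmanPolytope (G n)) l} := by
        refine hn _ (fun i => hB _) fun x hx hx0 => ?_
        have hnn := mul_nonneg hA.le (sum_mul_nonneg_of_lt_success hW0 hW1 hB' y hy hx hx0)
        refine hnn.trans ?_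
        rw [mul_sum]
        refine sum_le_sum fun i _ => ?_
        rw [mul_left_comm]
        refine mul_le_mul_of_nonneg_left ?_ (hx0 i)
        have := hdec (y i)
        linarith
      rw [Set.indicator_of_mem hmem]
      have : 0 ≤ (1 - F y) / γ := div_nonneg (by linarith [hF1 y]) hγ0.le
      linarith
    · refine le_trans ?_ (Set.indicator_nonneg (fun _ _ => zero_le_one) _)
      have : 1 ≤ (1 - F y) / γ := by
        rw [le_div_iff₀ hγ0]
        linarith
      linarith
  calc 1 - (1 - llrProb p' st
        {l : Fin n → ℝ | LPsucceeds (feldmanPolytope (allDualChecks (G n))) l}) / γ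
      = ∑ y : Fin n → S, (∏ i, p (y i)) * (1 - (1 - F y) / γ) := by
        simp only [mul_sub, mul_div_assoc', sum_sub_distrib, ← sum_div, mul_one, htot, hprob]
    _ ≤ _ := sum_le_sum fun y _ =>
        mul_le_mul_of_nonneg_left (hpt y) (prod_nonneg fun i _ => hp _)

/-- A channel with a nonzero LLR has arbitrarily small distortions, obtained by a kernel,
which strictly decrease the mean of the LLRs, up to scaling. -/
theorem exists_distortion_kernel {p : S → ℝ} {st : S → S} (hst : ∀ a, st (st a) = a)
    (hp_pos : ∀ a, 0 < p a) (hp_sum : ∑ a, p a = 1) (hL : ∃ a, LLR p st a ≠ 0)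
    {α : ℝ} (hα : 0 < α) :
    ∃ (p' : S → ℝ) (W : S → S → ℝ) (A ρ : ℝ),
      (∀ a, 0 < p' a) ∧ ∑ a, p' a = 1 ∧ ∑ a, |p a - p' a| ≤ α ∧
      (∀ a b, 0 ≤ W a b) ∧ (∀ a, ∑ b, W a b = 1) ∧ (∀ b, p' b = ∑ a, p a * W a b) ∧
      0 < A ∧ 0 < ρ ∧ ∀ a, A * ∑ b, W a b * LLR p' st b ≤ LLR p st a - ρ := by
  classical
  set L := LLR p st with hLdef
  have hLst : ∀ a, L (st a) = -L a := LLR_involution hst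
  set m : S → ℝ := fun a => max (-L a) 0 with hm
  have hm0 : ∀ a, 0 ≤ m a := fun a => le_max_right _ _
  have hmst : ∀ a, m a - m (st a) = -L a := fun a => by
    simp only [hm, hLst]
    rcases le_total (L a) 0 with h | h
    · rw [max_eq_left (by linarith), max_eq_right (by linarith)]; ring
    · rw [max_eq_right (by linarith), max_eq_left (by linarith)]; ring
  have hmm : ∀ a, m a = 0 ∨ (m a = -L a ∧ m (st a) = 0) := fun a => by
    simp only [hm, hLst]
    rcases le_total (L a) 0 with h | h
    · exact Or.inr ⟨max_eq_left (by linarith), max_eq_right (by linarith)⟩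
    · exact Or.inl (max_eq_right (by linarith))
  obtain ⟨a₀, ha₀⟩ : ∃ a, 0 < m a := by
    obtain ⟨a, ha⟩ := hL
    rcases lt_or_gt_of_ne ha with h | h
    · exact ⟨a, lt_max_of_lt_left (by linarith)⟩
    · exact ⟨st a, lt_max_of_lt_left (by rw [hLst]; linarith)⟩
  set K := ∑ a, p a * m a with hK
  have hKpos : 0 < K := sum_pos' (fun a _ => mul_nonneg (hp_pos a).le (hm0 a))
    ⟨a₀, mem_univ _, mul_pos (hp_pos a₀) ha₀⟩
  set κ := K⁻¹ with hκ
  have hκpos : 0 < κ := inv_pos.2 hKpos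
  set ν : S → ℝ := fun a => κ * (p a * m a) with hν
  have hν0 : ∀ a, 0 ≤ ν a := fun a =>
    mul_nonneg hκpos.le (mul_nonneg (hp_pos a).le (hm0 a))
  have hν1 : ∑ a, ν a = 1 := by
    rw [← mul_sum, ← hK, hκ, inv_mul_cancel₀ hKpos.ne']
  set V := ∑ a, ν a * m a with hV
  have hVpos : 0 < V := sum_pos' (fun a _ => mul_nonneg (hν0 a) (hm0 a))
    ⟨a₀, mem_univ _, mul_pos (mul_pos hκpos (mul_pos (hp_pos a₀) ha₀)) ha₀⟩
  set B := ∑ a, m a with hB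
  have hmB : ∀ a, m a ≤ B := fun a => single_le_sum (fun a _ => hm0 a) (mem_univ a)
  have hden : 0 < 4 * (κ * B) ^ 2 + 1 := by positivity
  obtain ⟨t, ht0, htα, htκ, htV⟩ : ∃ t : ℝ, 0 < t ∧ 2 * t ≤ α ∧ κ * t ≤ 1 / 2 ∧
      4 * (κ * B) ^ 2 * t ≤ V := by
    refine ⟨min (α / 2) (min (1 / (2 * κ)) (V / (4 * (κ * B) ^ 2 + 1))), by positivity, ?_, ?_, ?_⟩
    · linarith [min_le_left (α / 2) (min (1 / (2 * κ)) (V / (4 * (κ * B) ^ 2 + 1)))]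
    · calc _ ≤ κ * (1 / (2 * κ)) := by
            gcongr
            exact (min_le_right _ _).trans (min_le_left _ _)
        _ = 1 / 2 := by field_simp
    · set t := min (α / 2) (min (1 / (2 * κ)) (V / (4 * (κ * B) ^ 2 + 1))) with ht
      have h1 : 0 < t := by positivity
      have h2 : t ≤ V / (4 * (κ * B) ^ 2 + 1) := (min_le_right _ _).trans (min_le_right _ _)
      rw [le_div_iff₀ hden] at h2
      linarith
  have h1t : 0 < 1 + t := by linarith
  have hu0 : 0 < κ * t := mul_pos hκpos ht0
  set u := κ * t with hu
  set p' : S → ℝ := fun a => (p a + t * ν a) / (1 + t) with hp'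
  set W : S → S → ℝ := fun a b => ((if a = b then 1 else 0) + t * ν b) / (1 + t) with hW
  have hp'_eq : ∀ a, p' a = p a * (1 + u * m a) / (1 + t) := fun a => by
    simp only [hp', hν, hu]; ring
  have hum : ∀ a, 0 < 1 + u * m a := fun a => by
    have := mul_nonneg hu0.le (hm0 a)
    linarith
  have hL' : ∀ a, LLR p' st a =
      L a + Real.log (1 + u * m a) - Real.log (1 + u * m (st a)) := fun a => by
    have e1 := (hp_pos a).ne'
    have e2 := (hp_pos (st a)).ne'
    have e3 := (hum a).ne'
    have e4 := (hum (st a)).ne'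
    rw [LLR, hp'_eq, hp'_eq, hLdef, LLR, div_div_div_cancel_right₀ h1t.ne',
      Real.log_div (mul_ne_zero e1 e3) (mul_ne_zero e2 e4), Real.log_mul e1 e3,
      Real.log_mul e2 e4, Real.log_div e1 e2]
    ring
  have hlog : ∀ a, LLR p' st a ≤ (1 - u) * L a + (u * m (st a)) ^ 2 := fun a => by
    rw [hL']
    have h1 := Real.log_le_sub_one_of_pos (hum a)
    have h2 := Real.one_sub_inv_le_log_of_pos (hum (st a))
    have h3 : u * m (st a) - (u * m (st a)) ^ 2 ≤ 1 - (1 + u * m (st a))⁻¹ := by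
      have hx := mul_nonneg hu0.le (hm0 (st a))
      set x := u * m (st a)
      have : 1 - (1 + x)⁻¹ = x - x ^ 2 + x ^ 3 / (1 + x) := by
        field_simp
        ring
      rw [this]
      have : 0 ≤ x ^ 3 / (1 + x) := by positivity
      linarith
    have h4 := hmst a
    have h5 : L a = m (st a) - m a := by linarith
    rw [h5]
    linarith
  have hνL : ∑ b, ν b * LLR p' st b ≤ -((1 - u) * V) := by
    rw [hV, mul_sum, ← sum_neg_distrib]
    refine sum_le_sum fun b _ => ?_
    rcases hmm b with h0 | ⟨h1, h2⟩
    · simp [hν, h0]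
    · have := hlog b
      rw [h2] at this
      have h3 := mul_le_mul_of_nonneg_left this (hν0 b)
      rw [h1]
      linarith
  have hu1 : 0 < 1 - u := by linarith
  refine ⟨p', W, (1 + t) / (1 - u), t * V / 2, fun a => ?_, ?_, ?_, fun a b => ?_, fun a => ?_,
    fun b => ?_, by positivity, by positivity, fun a => ?_⟩
  · exact div_pos (add_pos_of_pos_of_nonneg (hp_pos a) (mul_nonneg ht0.le (hν0 a))) h1t
  · rw [← sum_div, sum_add_distrib, ← mul_sum, hp_sum, hν1, mul_one, div_self h1t.ne']
  · calc ∑ a, |p a - p' a| ≤ ∑ a, t * (p a + ν a) := by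
          refine sum_le_sum fun a _ => ?_
          have : p a - p' a = t * (p a - ν a) / (1 + t) := by
            simp only [hp']
            field_simp
            ring
          have h1 := (hp_pos a).le
          have h2 := hν0 a
          rw [this, abs_div, abs_mul, abs_of_pos ht0, abs_of_pos h1t]
          refine (div_le_self (by positivity) (by linarith)).trans ?_
          gcongr
          rw [abs_le]
          constructor <;> linarith
      _ = 2 * t := by rw [← mul_sum, sum_add_distrib, hp_sum, hν1]; ring
      _ ≤ α := htα
  · have := mul_nonneg ht0.le (hν0 b)
    simp only [hW]
    split_ifs <;> positivity
  · simp only [hW]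
    rw [← sum_div, sum_add_distrib, ← mul_sum, hν1, sum_ite_eq, if_pos (mem_univ a), mul_one,
      div_self h1t.ne']
  · simp only [hW, hp', mul_div_assoc', ← sum_div, mul_add, sum_add_distrib, mul_ite, mul_one,
      mul_zero, sum_ite_eq', mem_univ, if_true, ← sum_mul, hp_sum, one_mul]
  · have hWL : ∑ b, W a b * LLR p' st b =
        (LLR p' st a + t * ∑ b, ν b * LLR p' st b) / (1 + t) := by
      simp only [hW, div_mul_eq_mul_div, ← sum_div, add_mul, sum_add_distrib, ite_mul, one_mul,
        zero_mul, sum_ite_eq, mem_univ, if_true, mul_sum, mul_assoc]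
    have hsq : (u * m (st a)) ^ 2 ≤ (1 - u) * (t * V / 2) := by
      have h1 : (u * m (st a)) ^ 2 ≤ (u * B) ^ 2 := by
        have := hm0 (st a)
        have := hmB (st a)
        gcongr
      have h2 : (u * B) ^ 2 = t / 4 * (4 * (κ * B) ^ 2 * t) := by rw [hu]; ring
      have h3 : t / 4 * (4 * (κ * B) ^ 2 * t) ≤ t / 4 * V := by gcongr
      have h4 : 0 < t * V := by positivity
      nlinarith
    have h1 := hlog a
    have h2 := mul_le_mul_of_nonneg_left hνL ht0.le
    rw [hWL, div_mul_div_comm, mul_comm (1 - u), mul_div_mul_left _ _ h1t.ne', div_le_iff₀ hu1]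
    linarith

end Channel

/-- **Redundant checks do not lower the LP threshold on discrete MSB channels.**
Let `G` be an asymptotically strong, rigid family of Tanner graphs of bounded check degree
`d`, and `Ḡ` the family obtained by adding all redundant checks.  If there is an `α > 0`
such that for every `α`-distortion of the discrete MSB channel `(S, p, st)` the
`P(Ḡ_n)`-LP decoder succeeds with high probability, then the `P(G_n)`-LP decoder succeeds
on `(S, p, st)` with high probability. -/
theorem redundant_checks_msb {S : Type*} [Fintype S]
    (p : S → ℝ) (st : S → S)
    (hst : ∀ a, st (st a) = a)
    (hp_pos : ∀ a, 0 < p a) (hp_sum : ∑ a, p a = 1)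
    (d : ℕ) (G : ∀ n : ℕ, Set (Fin n → ZMod 2))
    (hG : ∀ n, ∀ h ∈ G n, h ≠ 0 ∧ hammingNorm h ≤ d)
    (hstrong : AsympStrong G) (hrigid : Rigid d G)
    (hα : ∃ α > (0 : ℝ), ∀ p' : S → ℝ,
      (∀ a, 0 < p' a) → (∑ a, p' a = 1) → (∑ a, |p a - p' a|) ≤ α →
      Tendsto (fun n => llrProb p' st
          {l : Fin n → ℝ | LPsucceeds (feldmanPolytope (allDualChecks (G n))) l})
        atTop (nhds 1)) :
    Tendsto (fun n => llrProb p st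
        {l : Fin n → ℝ | LPsucceeds (feldmanPolytope (G n)) l})
      atTop (nhds 1) := by
  obtain ⟨α, hα0, hα⟩ := hα
  by_cases hL : ∃ a, LLR p st a ≠ 0
  · obtain ⟨p', W, A, ρ, hp'0, hp'1, hp'α, hW0, hW1, hp'W, hA, hρ, hdec⟩ :=
      exists_distortion_kernel hst hp_pos hp_sum hL hα0
    exact tendsto_llrProb_of_kernel (fun a => (hp_pos a).le) hp_sum hstrong hrigid hW0 hW1
      hp'W hA hρ hdec (hα p' hp'0 hp'1 hp'α)
  · push Not at hL
    have hlim := hα p hp_pos hp_sum (by simpa using hα0.le)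
    refine tendsto_of_tendsto_of_tendsto_of_le_of_le' hlim tendsto_const_nhds ?_
      (Eventually.of_forall fun n => llrProb_le_one (fun a => (hp_pos a).le) hp_sum _)
    filter_upwards [eventually_LPsucceeds_of_forall_nonneg hstrong hrigid le_rfl one_pos]
      with n hn
    refine sum_le_sum fun y _ => mul_le_mul_of_nonneg_left ?_
      (prod_nonneg fun i _ => (hp_pos _).le)
    by_cases hy : LPsucceeds (feldmanPolytope (allDualChecks (G n))) (fun i => LLR p st (y i))
    · rw [Set.indicator_of_mem, Set.indicator_of_mem]
      · refine hn _ (fun i => by simp [hL]) fun x hx _ => ?_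
        by_cases hx0 : x = 0
        · simp [hx0]
        · simpa [hL] using hy x hx hx0
      · exact hy
    · rw [Set.indicator_of_notMem (by simpa using hy)]
      exact Set.indicator_nonneg (fun _ _ => zero_le_one) _
end
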